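/- arXiv:1504.07411 — 3 statements merged into one kernel-verified Lean document; each statement's English description precedes it below -/
import Mathlib

section
/- Let A = {n² : n ≥ 1} be the set of positive squares. Then for every ε > 0 there exists x_0 such that for all x ≥ x_0, s_A(x) ≥ exp((log 2 − ε)·(log x)/(log log x)), where s_A(x) = max_{n ≤ x} R_A(n) and R_A(n) counts representations of n as an ordered sum a + a' with a ≤ a', a, a' ∈ A. -/
open Filter

/-- Number of representations of `n` as `a i + a j`, `i ≤ j` (indices into the sequence `a`).
Since `a` is strictly increasing in all uses, `a i ≥ i`, so indices are bounded by `n`. -/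
def Rf (a : ℕ → ℕ) (n : ℕ) : ℕ :=
  ((Finset.range (n+1) ×ˢ Finset.range (n+1)).filter
    (fun p => p.1 ≤ p.2 ∧ a p.1 + a p.2 = n)).card

/-- `s_A(x) = max_{n ≤ x} R_A(n)`. -/
def sf (a : ℕ → ℕ) (x : ℕ) : ℕ := (Finset.range (x+1)).sup (Rf a)

/-- `d_{A,B}(x) = max_{t : a_t ≤ x ∨ b_t ≤ x} |a_t - b_t|`. For strictly increasing
sequences any such index `t` satisfies `t ≤ x`. -/
def df (a b : ℕ → ℕ) (x : ℕ) : ℕ :=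
  (Finset.range (x+1)).sup (fun t => if a t ≤ x ∨ b t ≤ x then Nat.dist (a t) (b t) else 0)

/-- Number of representations of `n` as `p + q` with `p ≤ q`, `p, q ∈ A`. -/
noncomputable def RS (A : Set ℕ) (n : ℕ) : ℕ :=
  Nat.card {p : ℕ × ℕ // p.1 ∈ A ∧ p.2 ∈ A ∧ p.1 ≤ p.2 ∧ p.1 + p.2 = n}

/-- `s_A(x) = max_{n ≤ x} R_A(n)` for a set `A`. -/
noncomputable def sS (A : Set ℕ) (x : ℕ) : ℕ := (Finset.range (x+1)).sup (RS A)

/-- The set of positive squares. -/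
def squares : Set ℕ := {m | ∃ n : ℕ, 1 ≤ n ∧ m = n ^ 2}

/-- If `π` has odd prime norm `p`, then a multiple of `π` is never `w * star π` with `w` of norm
prime to `p`. -/
lemma gaussianInt_mul_ne_mul_star {p : ℕ} (hp : p.Prime) (hp2 : p ≠ 2) {π z w : GaussianInt}
    (hπ : π.norm = p) (hw : ¬ (p : ℤ) ∣ w.norm) : z * π ≠ w * star π := by
  intro h
  have hpZ : Prime (p : ℤ) := Nat.prime_iff_prime_int.mp hp
  have hirr : Irreducible π := by
    rw [irreducible_iff]
    constructor
    · intro hu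
      have := Zsqrtd.norm_eq_one_iff.mpr hu
      rw [hπ] at this
      simp at this
      exact hp.one_lt.ne' this
    · intro a b hab
      have h1 : a.norm.natAbs * b.norm.natAbs = p := by
        rw [← Int.natAbs_mul, ← Zsqrtd.norm_mul, ← hab, hπ]; simp
      rcases (Nat.prime_mul_iff.mp (h1 ▸ hp)) with ⟨_, hb⟩ | ⟨_, ha⟩
      · exact Or.inr (Zsqrtd.norm_eq_one_iff.mp hb)
      · exact Or.inl (Zsqrtd.norm_eq_one_iff.mp ha)
  have hprime : Prime π := hirr.prime
  rcases hprime.dvd_or_dvd (Dvd.intro_left z h) with h1 | h1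
  · obtain ⟨c, rfl⟩ := h1
    rw [Zsqrtd.norm_mul, hπ] at hw
    exact hw (Dvd.intro _ rfl)
  · have h2 : π ∣ ((2 * π.re : ℤ) : GaussianInt) := by
      have : ((2 * π.re : ℤ) : GaussianInt) = π + star π := by
        ext <;> simp [two_mul]
      rw [this]
      exact dvd_add dvd_rfl h1
    obtain ⟨c, hc⟩ := h2
    have h3 : (p : ℤ) ∣ (2 * π.re) * (2 * π.re) := by
      have := congrArg Zsqrtd.norm hc
      rw [Zsqrtd.norm_mul, hπ, Zsqrtd.norm_intCast] at this
      exact ⟨_, this⟩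
    have h4 : (p : ℤ) ∣ π.re := by
      have h5 : (p : ℤ) ∣ 2 * π.re := (hpZ.dvd_or_dvd h3).elim id id
      refine (hpZ.dvd_or_dvd h5).resolve_left fun h6 => hp2 ?_
      have : p ∣ 2 := by exact_mod_cast h6
      exact (Nat.prime_dvd_prime_iff_eq hp Nat.prime_two).mp this
    have hn : π.re * π.re + π.im * π.im = p := by
      rw [← hπ, Zsqrtd.norm_def]; ring
    have h5 : (p : ℤ) ∣ π.im := by
      have : (p : ℤ) ∣ π.im * π.im := by
        exact (dvd_add_right (h4.mul_right π.re)).mp (dvd_of_eq hn.symm)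
      exact (hpZ.dvd_or_dvd this).elim id id
    have h6 : (p : ℤ) * p ∣ p := by
      nth_rewrite 3 [← hn]
      exact dvd_add (mul_dvd_mul h4 h4) (mul_dvd_mul h5 h5)
    exact hpZ.not_isUnit (isUnit_of_dvd_one ((mul_dvd_mul_iff_left hpZ.ne_zero).mp (by simpa using h6)))

lemma exists_gaussianInt_norm_eq_prod (s : Finset ℕ) (hs : ∀ p ∈ s, p.Prime ∧ p % 4 = 1) :
    ∃ T : Finset GaussianInt, T.card = 2 ^ s.card ∧ ∀ z ∈ T, z.norm = ((∏ p ∈ s, p : ℕ) : ℤ) := by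
  classical
  induction s using Finset.induction_on with
  | empty => exact ⟨{1}, by simp, by simp⟩
  | insert p s hps ih =>
    obtain ⟨T, hT, hTn⟩ := ih fun q hq => hs q (Finset.mem_insert_of_mem hq)
    obtain ⟨hp, hp4⟩ := hs p (Finset.mem_insert_self p s)
    have := Fact.mk hp
    obtain ⟨a, b, hab⟩ := Nat.Prime.sq_add_sq (p := p) (by omega)
    set π : GaussianInt := ⟨a, b⟩ with hπdef
    have hπ : π.norm = p := by
      rw [Zsqrtd.norm_def, hπdef, ← hab]; push_cast; ring
    have hπs : (star π).norm = p := by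
      rw [Zsqrtd.norm_def, hπdef, ← hab]; simp; ring
    have hπ0 : π ≠ 0 := by
      rintro h; rw [h] at hπ; simp at hπ; exact hp.ne_zero (by exact_mod_cast hπ.symm)
    have hπs0 : star π ≠ 0 := by simpa using hπ0
    refine ⟨T.image (· * π) ∪ T.image (· * star π), ?_, ?_⟩
    · rw [Finset.card_union_of_disjoint, Finset.card_image_of_injective _ (mul_left_injective₀ hπ0),
        Finset.card_image_of_injective _ (mul_left_injective₀ hπs0), hT,
        Finset.card_insert_of_notMem hps, pow_succ, mul_two]
      rw [Finset.disjoint_left]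
      intro x hx hx'
      obtain ⟨z, -, rfl⟩ := Finset.mem_image.mp hx
      obtain ⟨w, hw, hzw⟩ := Finset.mem_image.mp hx'
      refine gaussianInt_mul_ne_mul_star hp (by omega) hπ (w := w) ?_ hzw.symm
      rw [hTn w hw]
      intro hd
      have hd : p ∣ ∏ q ∈ s, q := by exact_mod_cast hd
      obtain ⟨q, hq, hpq⟩ := (Prime.dvd_finsetProd_iff hp.prime _).mp hd
      have := (Nat.prime_dvd_prime_iff_eq hp (hs q (Finset.mem_insert_of_mem hq)).1).mp hpq
      exact hps (this ▸ hq)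
    · intro z hz
      rw [Finset.prod_insert hps]
      rcases Finset.mem_union.mp hz with h | h <;> obtain ⟨w, hw, rfl⟩ := Finset.mem_image.mp h
      · simp only [Zsqrtd.norm_mul, hTn w hw, hπ]; push_cast; ring
      · simp only [Zsqrtd.norm_mul, hTn w hw, hπs]; push_cast; ring

lemma squarefree_prod_of_forall_prime (s : Finset ℕ) (hs : ∀ p ∈ s, p.Prime) :
    Squarefree (∏ p ∈ s, p) := by
  refine Finset.squarefree_prod_of_pairwise_isCoprime ?_ fun p hp => (hs p hp).prime.squarefree
  intro p hp q hq hpq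
  exact Nat.coprime_iff_isRelPrime.mp ((Nat.coprime_primes (hs p hp) (hs q hq)).mpr hpq)

lemma card_le_eight_mul_RS_squares {n : ℕ} (hn : Squarefree n) (hn1 : n ≠ 1)
    (T : Finset GaussianInt) (hT : ∀ z ∈ T, z.norm = n) : T.card ≤ 8 * RS squares n := by
  set R := {p : ℕ × ℕ // p.1 ∈ squares ∧ p.2 ∈ squares ∧ p.1 ≤ p.2 ∧ p.1 + p.2 = n}
  have hfin : Finite R := by
    refine Set.Finite.to_subtype (((Set.finite_Iic n).prod (Set.finite_Iic n)).subset ?_)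
    rintro ⟨a, b⟩ ⟨-, -, -, h⟩
    simp only [Set.mem_prod, Set.mem_Iic] at h ⊢
    omega
  have hsum : ∀ z ∈ T, z.re.natAbs ^ 2 + z.im.natAbs ^ 2 = n := by
    intro z hz
    have := hT z hz
    rw [Zsqrtd.norm_def] at this
    zify
    rw [sq_abs, sq_abs]
    linarith
  have hne : ∀ b : ℕ, b ^ 2 ≠ n := by
    intro b hb
    have := hn b (by rw [← hb, sq])
    rw [Nat.isUnit_iff] at this
    subst this
    simp at hb
    exact hn1 hb.symm
  have hpos : ∀ z ∈ T, 1 ≤ z.re.natAbs ∧ 1 ≤ z.im.natAbs := by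
    intro z hz
    have h := hsum z hz
    constructor <;> rw [Nat.one_le_iff_ne_zero] <;> intro h0 <;> rw [h0] at h <;>
      simp only [ne_eq, OfNat.ofNat_ne_zero, not_false_eq_true, zero_pow, zero_add, add_zero] at h
    · exact hne _ h
    · exact hne _ h
  let f : T → R × (Bool × Bool × Bool) := fun z =>
    (⟨(min (z.1.re.natAbs ^ 2) (z.1.im.natAbs ^ 2), max (z.1.re.natAbs ^ 2) (z.1.im.natAbs ^ 2)), by
      have hp := hpos z.1 z.2
      have h1 : z.1.re.natAbs ^ 2 ∈ squares := ⟨_, hp.1, rfl⟩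
      have h2 : z.1.im.natAbs ^ 2 ∈ squares := ⟨_, hp.2, rfl⟩
      refine ⟨?_, ?_, min_le_max, by simpa using hsum z.1 z.2⟩
      · rcases min_choice (z.1.re.natAbs ^ 2) (z.1.im.natAbs ^ 2) with h | h <;> simpa only [h]
      · rcases max_choice (z.1.re.natAbs ^ 2) (z.1.im.natAbs ^ 2) with h | h <;> simpa only [h]⟩,
      decide (0 ≤ z.1.re), decide (0 ≤ z.1.im), decide (z.1.re.natAbs ^ 2 ≤ z.1.im.natAbs ^ 2))
  have hf : Function.Injective f := by
    rintro ⟨z, hz⟩ ⟨w, hw⟩ h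
    have h1 := congrArg (fun u => u.1.1.1) h
    have h2 := congrArg (fun u => u.1.1.2) h
    have h345 := congrArg Prod.snd h
    simp only [f, Prod.mk.injEq, decide_eq_decide] at h1 h2 h345
    obtain ⟨h3, h4, h5⟩ := h345
    have key : z.re.natAbs ^ 2 = w.re.natAbs ^ 2 ∧ z.im.natAbs ^ 2 = w.im.natAbs ^ 2 := by
      omega
    have k1 := Nat.pow_left_injective (n := 2) (by norm_num) key.1
    have k2 := Nat.pow_left_injective (n := 2) (by norm_num) key.2
    rw [Subtype.mk.injEq]
    ext <;> omega
  have h := Nat.card_le_card_of_injective f hf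
  rw [Nat.card_prod, Nat.card_eq_fintype_card (α := T), Fintype.card_coe,
    Nat.card_eq_fintype_card (α := Bool × Bool × Bool)] at h
  simp only [Fintype.card_prod, Fintype.card_bool] at h
  have hR : RS squares n = Nat.card R := rfl
  omega

lemma two_pow_le_eight_mul_sS_squares (s : Finset ℕ) (hs : ∀ p ∈ s, p.Prime ∧ p % 4 = 1)
    (hne : s.Nonempty) {x : ℕ} (hx : ∏ p ∈ s, p ≤ x) : 2 ^ s.card ≤ 8 * sS squares x := by
  obtain ⟨T, hT, hTn⟩ := exists_gaussianInt_norm_eq_prod s hs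
  have hn1 : ∏ p ∈ s, p ≠ 1 := by
    obtain ⟨p, hp⟩ := hne
    intro h
    have := Finset.dvd_prod_of_mem (fun p => p) hp
    rw [h] at this
    exact (hs p hp).1.one_lt.ne' (Nat.dvd_one.mp this)
  have h1 := card_le_eight_mul_RS_squares
    (squarefree_prod_of_forall_prime s fun p hp => (hs p hp).1) hn1 T hTn
  have h2 : RS squares (∏ p ∈ s, p) ≤ sS squares x :=
    Finset.le_sup (f := RS squares) (Finset.mem_range.mpr (by omega))
  omega

section Mertens

open Finset ArithmeticFunction Chebyshev

lemma alternating_sum_χ₄_mul_bounds (f : ℕ → ℝ) (N M : ℕ) (h0 : ∀ n, M < n → 0 ≤ f n)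
    (hf : ∀ n, M < n → f (n + 1) ≤ f n) :
    ((M % 4 = 0 ∨ M % 4 = 3) → 0 ≤ ∑ n ∈ Ioc M (M + N), (ZMod.χ₄ n : ℝ) * f n ∧
      ∑ n ∈ Ioc M (M + N), (ZMod.χ₄ n : ℝ) * f n ≤ f (M + 1)) ∧
    ((M % 4 = 1 ∨ M % 4 = 2) → -f (M + 1) ≤ ∑ n ∈ Ioc M (M + N), (ZMod.χ₄ n : ℝ) * f n ∧
      ∑ n ∈ Ioc M (M + N), (ZMod.χ₄ n : ℝ) * f n ≤ 0) := by
  induction N generalizing M with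
  | zero => simp [h0 (M + 1)]
  | succ N ih =>
    have ih := ih (M + 1) (fun n hn => h0 n (by omega)) (fun n hn => hf n (by omega))
    have h1 := h0 (M + 1) (by omega)
    have h2 := h0 (M + 2) (by omega)
    have h3 := hf (M + 1) (by omega)
    have hs : ∑ n ∈ Ioc M (M + (N + 1)), (ZMod.χ₄ n : ℝ) * f n =
        (ZMod.χ₄ (M + 1 : ℕ) : ℝ) * f (M + 1) +
          ∑ n ∈ Ioc (M + 1) (M + 1 + N), (ZMod.χ₄ n : ℝ) * f n := by
      rw [show M + (N + 1) = M + 1 + N by ring,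
        ← Finset.sum_Ioc_consecutive _ (Nat.le_succ M) (show M + 1 ≤ M + 1 + N by omega)]
      simp
    rw [hs, ZMod.χ₄_nat_eq_if_mod_four]
    have hM : M % 4 = 0 ∨ M % 4 = 1 ∨ M % 4 = 2 ∨ M % 4 = 3 := by omega
    rcases hM with h | h | h | h
    · obtain ⟨ih1, ih2⟩ := ih.2 (by omega)
      simp only [show (M + 1) % 2 ≠ 0 by omega, show (M + 1) % 4 = 1 by omega, if_true, if_false, h]
      refine ⟨fun _ => ⟨?_, ?_⟩, fun h => by omega⟩ <;> push_cast <;> linarith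
    · obtain ⟨ih1, ih2⟩ := ih.2 (by omega)
      simp only [show (M + 1) % 2 = 0 by omega, if_true, h]
      refine ⟨fun h => by omega, fun _ => ⟨?_, ?_⟩⟩ <;> push_cast <;> linarith
    · obtain ⟨ih1, ih2⟩ := ih.1 (by omega)
      simp only [show (M + 1) % 2 ≠ 0 by omega, show (M + 1) % 4 ≠ 1 by omega, if_false, h]
      refine ⟨fun h => by omega, fun _ => ⟨?_, ?_⟩⟩ <;> push_cast <;> linarith
    · obtain ⟨ih1, ih2⟩ := ih.1 (by omega)
      simp only [show (M + 1) % 2 = 0 by omega, if_true, h]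
      refine ⟨fun _ => ⟨?_, ?_⟩, fun h => by omega⟩ <;> push_cast <;> linarith

/-- A partial sum of `χ₄ n * f n` is bounded by the first value of `f` when `f` decreases. -/
lemma abs_sum_χ₄_mul_le (f : ℕ → ℝ) {M N : ℕ} (hMN : M ≤ N) (h0 : ∀ n, M < n → 0 ≤ f n)
    (hf : ∀ n, M < n → f (n + 1) ≤ f n) :
    |∑ n ∈ Ioc M N, (ZMod.χ₄ n : ℝ) * f n| ≤ f (M + 1) := by
  obtain ⟨k, rfl⟩ := Nat.exists_eq_add_of_le hMN
  have h1 := h0 (M + 1) (by omega)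
  obtain ⟨h2, h3⟩ := alternating_sum_χ₄_mul_bounds f k M h0 hf
  have hM : (M % 4 = 0 ∨ M % 4 = 3) ∨ (M % 4 = 1 ∨ M % 4 = 2) := by omega
  rcases hM with h | h
  · have := h2 h
    exact abs_le.mpr ⟨by linarith, this.2⟩
  · have := h3 h
    exact abs_le.mpr ⟨this.1, by linarith⟩

lemma abs_χ₄_natCast_le_one (n : ℕ) : |(ZMod.χ₄ n : ℝ)| ≤ 1 := by
  rw [ZMod.χ₄_nat_eq_if_mod_four]
  split_ifs <;> simp

lemma abs_sum_χ₄_div_le {M N : ℕ} (hMN : M ≤ N) :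
    |∑ n ∈ Ioc M N, (ZMod.χ₄ n : ℝ) / n| ≤ 1 / ((M : ℝ) + 1) := by
  have := abs_sum_χ₄_mul_le (fun n : ℕ => 1 / (n : ℝ)) hMN (fun n _ => by positivity) (by
    intro n hn
    have : (0 : ℝ) < n := by exact_mod_cast (by omega : 0 < n)
    push_cast
    gcongr
    linarith)
  simpa [div_eq_mul_inv] using this

lemma abs_sum_χ₄_mul_log_div_le (N : ℕ) :
    |∑ n ∈ Ioc 0 N, (ZMod.χ₄ n : ℝ) * (Real.log n / n)| ≤ 1 := by
  have hlog (n : ℕ) (hn : 2 < n) : Real.log (n + 1 : ℕ) / (n + 1 : ℕ) ≤ Real.log n / n := by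
    have h3 : (3 : ℝ) ≤ n := by exact_mod_cast hn
    have he := Real.exp_one_lt_three
    refine Real.log_div_self_antitoneOn ?_ ?_ (by simp) <;> simp only [Set.mem_Ici] <;>
      push_cast <;> linarith
  have h2 : ∑ n ∈ Ioc (0 : ℕ) 2, (ZMod.χ₄ n : ℝ) * (Real.log n / n) = 0 := by
    rw [Finset.sum_Ioc_succ_top (by norm_num), Finset.sum_Ioc_succ_top (by norm_num)]
    simp
  rcases le_or_gt N 2 with h | h
  · interval_cases N
    · simp
    · simp
    · rw [h2]
      simp
  · have h1 := abs_sum_χ₄_mul_le (fun n : ℕ => Real.log n / n) h.le (fun n _ => by positivity) hlog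
    rw [← Finset.sum_Ioc_consecutive _ (Nat.zero_le 2) h.le]
    rw [h2, zero_add]
    refine h1.trans ?_
    have := Real.log_le_sub_one_of_pos (x := 3) (by norm_num)
    norm_num
    linarith

lemma sum_Ioc_χ₄_mul_log_div (N : ℕ) :
    ∑ n ∈ Ioc 0 N, (ZMod.χ₄ n : ℝ) * (Real.log n / n) =
      ∑ d ∈ Ioc 0 N, (ZMod.χ₄ d : ℝ) * (Λ d / d) * ∑ m ∈ Ioc 0 (N / d), (ZMod.χ₄ m : ℝ) / m := by
  let f : ArithmeticFunction ℝ := ⟨fun n => (ZMod.χ₄ n : ℝ) * (Λ n / n), by simp⟩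
  let g : ArithmeticFunction ℝ := ⟨fun n => (ZMod.χ₄ n : ℝ) / n, by simp⟩
  refine Eq.trans (Finset.sum_congr rfl fun n hn => ?_) (sum_Ioc_mul_eq_sum_sum f g N)
  rw [mul_apply]
  calc (ZMod.χ₄ n : ℝ) * (Real.log n / n)
      = ∑ x ∈ n.divisorsAntidiagonal, (ZMod.χ₄ n : ℝ) / n * Λ x.1 := by
        rw [Nat.sum_divisorsAntidiagonal (fun i _ => ((ZMod.χ₄ n : ℝ) / n * Λ i : ℝ)), ← Finset.mul_sum,
          vonMangoldt_sum]
        ring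
    _ = _ := by
        refine Finset.sum_congr rfl fun x hx => ?_
        have hx := (Nat.mem_divisorsAntidiagonal.mp hx).1
        rw [← hx]
        simp only [f, g, coe_mk]
        push_cast
        rw [map_mul]
        push_cast
        rw [mul_div_mul_comm]
        ring

lemma psi_natCast (N : ℕ) : ψ N = ∑ n ∈ Ioc 0 N, Λ n := by
  rw [psi, Nat.floor_natCast]

lemma abs_sum_χ₄_mul_vonMangoldt_div_le (N : ℕ) :
    |∑ n ∈ Ioc 0 N, (ZMod.χ₄ n : ℝ) * (Λ n / n)| ≤ 2 * (Real.log 4 + 5) := by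
  rcases Nat.eq_zero_or_pos N with rfl | hN
  · simp; positivity
  have hNR : (0 : ℝ) < N := by exact_mod_cast hN
  set S := ∑ n ∈ Ioc 0 N, (ZMod.χ₄ n : ℝ) * (Λ n / n) with hS
  set V := ∑ m ∈ Ioc 0 N, (ZMod.χ₄ m : ℝ) / m with hV
  have hV2 : 1 / 2 ≤ V := by
    rw [hV, ← Finset.sum_Ioc_consecutive _ (Nat.zero_le 1) hN]
    have := (abs_le.mp (abs_sum_χ₄_div_le (M := 1) hN)).1
    norm_num at this ⊢
    linarith
  have hdiff : |V * S - ∑ n ∈ Ioc 0 N, (ZMod.χ₄ n : ℝ) * (Real.log n / n)| ≤ Real.log 4 + 4 := by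
    rw [sum_Ioc_χ₄_mul_log_div, hS, Finset.mul_sum, ← Finset.sum_sub_distrib]
    calc _ ≤ ∑ d ∈ Ioc 0 N, Λ d / N := by
          refine (Finset.abs_sum_le_sum_abs _ _).trans (Finset.sum_le_sum fun d hd => ?_)
          have hd0 : 0 < d := (Finset.mem_Ioc.mp hd).1
          have hdR : (0 : ℝ) < d := by exact_mod_cast hd0
          have h1 : V = ∑ m ∈ Ioc 0 (N / d), (ZMod.χ₄ m : ℝ) / m +
              ∑ m ∈ Ioc (N / d) N, (ZMod.χ₄ m : ℝ) / m := by
            rw [Finset.sum_Ioc_consecutive _ (Nat.zero_le _) (Nat.div_le_self N d)]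
          have h2 := abs_sum_χ₄_div_le (Nat.div_le_self N d)
          have h3 : (N : ℝ) < d * ((N / d : ℕ) + 1) := by
            exact_mod_cast Nat.lt_mul_div_succ N hd0
          have h4 : 1 / (((N / d : ℕ) : ℝ) + 1) ≤ d / N := by
            rw [div_le_div_iff₀ (by positivity) hNR]
            linarith
          rw [h1, show ∀ a b c : ℝ, (a + b) * c - c * a = c * b by intros; ring, abs_mul, abs_mul]
          have h5 : |Λ d / d| = Λ d / d := abs_of_nonneg (div_nonneg vonMangoldt_nonneg hdR.le)
          rw [h5]
          have h6 : (0 : ℝ) ≤ Λ d / d := div_nonneg vonMangoldt_nonneg hdR.le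
          calc _ ≤ 1 * (Λ d / d) * (d / N) := by
                gcongr
                · exact abs_χ₄_natCast_le_one d
                · exact h2.trans h4
            _ = Λ d / N := by field_simp
      _ = ψ N / N := by rw [← Finset.sum_div, psi_natCast]
      _ ≤ _ := by
          rw [div_le_iff₀ hNR]
          exact psi_le_const_mul_self hNR.le
  have h1 : |V * S| ≤ Real.log 4 + 5 := by
    have h2 := abs_sum_χ₄_mul_log_div_le N
    rw [abs_le] at *
    constructor <;> linarith
  rw [abs_mul, abs_of_nonneg (by linarith : 0 ≤ V)] at h1
  nlinarith [abs_nonneg S]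

lemma sum_Ioc_vonMangoldt_mul_div (N : ℕ) :
    ∑ d ∈ Ioc 0 N, Λ d * ((N / d : ℕ) : ℝ) = Real.log (N.factorial) := by
  rw [← sum_Ioc_mul_zeta_eq_sum, vonMangoldt_mul_zeta]
  induction N with
  | zero => simp
  | succ n ih =>
    rw [Finset.sum_Ioc_succ_top (Nat.zero_le n), ih, Nat.factorial_succ, Nat.cast_mul,
      Real.log_mul (by positivity) (by positivity), log_apply, add_comm]

lemma log_factorial_bounds {N : ℕ} (hN : 0 < N) :
    N * Real.log N - N ≤ Real.log N.factorial ∧ Real.log N.factorial ≤ N * Real.log N := by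
  constructor
  · have h1 := Stirling.le_log_factorial_stirling hN.ne'
    have h2 : 0 ≤ Real.log N := Real.log_natCast_nonneg N
    have h3 : 0 ≤ Real.log (2 * Real.pi) := Real.log_nonneg (by linarith [Real.pi_gt_three])
    linarith
  · rw [← Real.log_pow]
    exact Real.log_le_log (by positivity) (by exact_mod_cast Nat.factorial_le_pow N)

lemma sum_vonMangoldt_div_bounds {N : ℕ} (hN : 0 < N) :
    Real.log N - 1 ≤ ∑ d ∈ Ioc 0 N, Λ d / d ∧
      ∑ d ∈ Ioc 0 N, Λ d / d ≤ Real.log N + (Real.log 4 + 4) := by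
  have hNR : (0 : ℝ) < N := by exact_mod_cast hN
  obtain ⟨h1, h2⟩ := log_factorial_bounds hN
  rw [← sum_Ioc_vonMangoldt_mul_div] at h1 h2
  constructor
  · have h3 : ∑ d ∈ Ioc 0 N, Λ d * ((N / d : ℕ) : ℝ) ≤ N * ∑ d ∈ Ioc 0 N, Λ d / d := by
      rw [Finset.mul_sum]
      refine Finset.sum_le_sum fun d hd => ?_
      calc Λ d * ((N / d : ℕ) : ℝ) ≤ Λ d * (N / d) :=
            mul_le_mul_of_nonneg_left Nat.cast_div_le vonMangoldt_nonneg
        _ = N * (Λ d / d) := by ring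
    have : N * (Real.log N - 1) ≤ N * ∑ d ∈ Ioc 0 N, Λ d / d := by linarith
    exact le_of_mul_le_mul_left this hNR
  · have h3 : N * ∑ d ∈ Ioc 0 N, Λ d / d ≤ ∑ d ∈ Ioc 0 N, Λ d * ((N / d : ℕ) : ℝ) + ψ N := by
      rw [Finset.mul_sum, psi_natCast, ← Finset.sum_add_distrib]
      refine Finset.sum_le_sum fun d hd => ?_
      have hd0 : 0 < d := (Finset.mem_Ioc.mp hd).1
      have hdR : (0 : ℝ) < d := by exact_mod_cast hd0
      have h4 : (N : ℝ) / d ≤ (N / d : ℕ) + 1 := by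
        rw [div_le_iff₀ hdR]
        have : (N : ℝ) < d * ((N / d : ℕ) + 1) := by exact_mod_cast Nat.lt_mul_div_succ N hd0
        linarith
      calc N * (Λ d / d) = Λ d * (N / d) := by ring
        _ ≤ Λ d * ((N / d : ℕ) + 1) := mul_le_mul_of_nonneg_left h4 vonMangoldt_nonneg
        _ = _ := by ring
    have h5 := psi_le_const_mul_self hNR.le
    have : N * ∑ d ∈ Ioc 0 N, Λ d / d ≤ N * (Real.log N + (Real.log 4 + 4)) := by linarith
    exact le_of_mul_le_mul_left this hNR

/-- The primes up to `N` that are congruent to `1` modulo `4`. -/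
def primesOneModFour (N : ℕ) : Finset ℕ := {p ∈ Ioc 0 N | p.Prime ∧ p % 4 = 1}

lemma mul_log_div_sub_le_card_primesOneModFour {M N : ℕ} (hM : 2 ≤ M) (hMN : M ≤ N) :
    M * (Real.log N - Real.log M - (5 * Real.log 4 + 25)) ≤
      2 * (primesOneModFour N).card * Real.log N + 4 * √N * Real.log N := by
  have hN1 : (1 : ℝ) ≤ N := by exact_mod_cast (by omega : 1 ≤ N)
  have hlogN : 0 ≤ Real.log N := Real.log_nonneg hN1
  have h1 : Real.log N - Real.log M - (5 * Real.log 4 + 25) ≤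
      ∑ n ∈ Ioc M N, (1 + (ZMod.χ₄ n : ℝ)) * (Λ n / n) := by
    have a1 := (sum_vonMangoldt_div_bounds (by omega : 0 < N)).1
    have a2 := (sum_vonMangoldt_div_bounds (by omega : 0 < M)).2
    have a3 := (abs_le.mp (abs_sum_χ₄_mul_vonMangoldt_div_le N)).1
    have a4 := (abs_le.mp (abs_sum_χ₄_mul_vonMangoldt_div_le M)).2
    rw [← Finset.sum_Ioc_consecutive _ (Nat.zero_le M) hMN] at a1 a3
    simp only [add_mul, one_mul, Finset.sum_add_distrib]
    linarith
  have hχ (n : ℕ) : 0 ≤ 1 + (ZMod.χ₄ n : ℝ) ∧ 1 + (ZMod.χ₄ n : ℝ) ≤ 2 := by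
    have := abs_le.mp (abs_χ₄_natCast_le_one n)
    constructor <;> linarith
  have h2 : M * ∑ n ∈ Ioc M N, (1 + (ZMod.χ₄ n : ℝ)) * (Λ n / n) ≤
      ∑ n ∈ Ioc M N, (1 + (ZMod.χ₄ n : ℝ)) * Λ n := by
    rw [Finset.mul_sum]
    refine Finset.sum_le_sum fun n hn => ?_
    have hMn : (M : ℝ) ≤ n := by exact_mod_cast (Finset.mem_Ioc.mp hn).1.le
    have hn0 : (0 : ℝ) < n := by
      have : (2 : ℝ) ≤ M := by exact_mod_cast hM
      linarith
    have : M * (Λ n / n) ≤ Λ n := by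
      rw [← mul_div_assoc, div_le_iff₀ hn0, mul_comm]
      exact mul_le_mul_of_nonneg_left hMn vonMangoldt_nonneg
    calc _ = (1 + (ZMod.χ₄ n : ℝ)) * (M * (Λ n / n)) := by ring
      _ ≤ _ := mul_le_mul_of_nonneg_left this (hχ n).1
  have h3 : ∑ n ∈ Ioc M N, (1 + (ZMod.χ₄ n : ℝ)) * Λ n ≤
      ∑ n ∈ Ioc 0 N, ((if n.Prime ∧ n % 4 = 1 then 2 * Real.log N else 0) +
        (if ¬ n.Prime then 2 * Λ n else 0)) := by
    refine (Finset.sum_le_sum fun n hn => ?_).trans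
      (Finset.sum_le_sum_of_subset_of_nonneg (Finset.Ioc_subset_Ioc_left (Nat.zero_le M)) ?_)
    · obtain ⟨hMn, hnN⟩ := Finset.mem_Ioc.mp hn
      by_cases hp : n.Prime
      · have hodd := hp.eq_two_or_odd.resolve_left (by omega)
        have hle : Λ n ≤ Real.log N := by
          rw [vonMangoldt_apply_prime hp]
          exact Real.log_le_log (by exact_mod_cast hp.pos) (by exact_mod_cast hnN)
        by_cases h4 : n % 4 = 1
        · simp only [hp, h4, and_self, if_true, not_true, if_false, add_zero]
          exact mul_le_mul (hχ n).2 hle vonMangoldt_nonneg (by norm_num)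
        · rw [ZMod.χ₄_nat_three_mod_four (by omega)]
          simp [h4, hp]
      · simp only [hp, false_and, if_false, not_false_eq_true, if_true, zero_add]
        exact mul_le_mul_of_nonneg_right (hχ n).2 vonMangoldt_nonneg
    · intro n _ _
      have := vonMangoldt_nonneg (n := n)
      split_ifs <;> positivity
  rw [Finset.sum_add_distrib, ← Finset.sum_filter, ← Finset.sum_filter, Finset.sum_const,
    ← Finset.mul_sum] at h3
  have h4 := psi_sub_theta_le hN1
  rw [psi_sub_theta_eq_sum_not_prime, Nat.floor_natCast] at h4
  have h5 : (M : ℝ) * (Real.log N - Real.log M - (5 * Real.log 4 + 25)) ≤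
      M * ∑ n ∈ Ioc M N, (1 + (ZMod.χ₄ n : ℝ)) * (Λ n / n) :=
    mul_le_mul_of_nonneg_left h1 (Nat.cast_nonneg M)
  rw [nsmul_eq_mul] at h3
  have h6 : (primesOneModFour N).card = #{n ∈ Ioc 0 N | n.Prime ∧ n % 4 = 1} := rfl
  rw [h6]
  linarith

end Mertens

lemma eventually_rpow_le_card_primesOneModFour {c : ℝ} (hc : c < 1) :
    ∀ᶠ N : ℕ in atTop, (N : ℝ) ^ c ≤ (primesOneModFour N).card := by
  wlog hc2 : 1 / 2 ≤ c generalizing c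
  · filter_upwards [this (c := 1 / 2) (by norm_num) le_rfl, eventually_ge_atTop 1] with N hN hN1
    exact (Real.rpow_le_rpow_of_exponent_le (by exact_mod_cast hN1) (by linarith)).trans hN
  obtain ⟨d, hd, rfl⟩ : ∃ d : ℝ, 0 < d ∧ c = 1 - 2 * d := ⟨(1 - c) / 2, by linarith, by ring⟩
  have hlog : Tendsto (fun N : ℕ => Real.log N) atTop atTop :=
    Real.tendsto_log_atTop.comp tendsto_natCast_atTop_atTop
  have hpow : Tendsto (fun N : ℕ => (N : ℝ) ^ d) atTop atTop :=
    (tendsto_rpow_atTop hd).comp tendsto_natCast_atTop_atTop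
  filter_upwards [eventually_ge_atTop 2,
    hlog.eventually_ge_atTop ((Real.log 2 + (5 * Real.log 4 + 25)) / (d / 2)),
    hpow.eventually_ge_atTop (12 / d),
    ((tendsto_rpow_atTop (by linarith : 0 < 1 - d)).comp
      tendsto_natCast_atTop_atTop).eventually_gt_atTop 1] with N hN2 hN hNd hN1
  simp only [Function.comp_apply] at hN1
  have hNR : (2 : ℝ) ≤ N := by exact_mod_cast hN2
  have hN0 : (0 : ℝ) < N := by linarith
  have hlogpos : 0 < Real.log N := Real.log_pos (by linarith)
  set y := (N : ℝ) ^ (1 - d) with hy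
  set M := ⌈y⌉₊ with hMdef
  have hyM : y ≤ M := Nat.le_ceil y
  have hM2 : 2 ≤ M := by
    have : 1 < M := by exact_mod_cast hN1.trans_le hyM
    omega
  have hMN : M ≤ N := by
    refine Nat.ceil_le.mpr ?_
    calc y ≤ (N : ℝ) ^ (1 : ℝ) := Real.rpow_le_rpow_of_exponent_le (by linarith) (by linarith)
      _ = N := Real.rpow_one _
  have hlogM : Real.log M ≤ Real.log 2 + (1 - d) * Real.log N := by
    have h1 : (M : ℝ) ≤ 2 * y := by linarith [Nat.ceil_lt_add_one (by linarith : 0 ≤ y)]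
    calc Real.log M ≤ Real.log (2 * y) := Real.log_le_log (by linarith) h1
      _ = _ := by rw [Real.log_mul (by norm_num) (by linarith), hy, Real.log_rpow hN0]
  rw [div_le_iff₀ (by linarith)] at hN
  rw [div_le_iff₀ hd] at hNd
  have key := mul_log_div_sub_le_card_primesOneModFour hM2 hMN
  have h1 : y * (d / 2 * Real.log N) ≤
      2 * (primesOneModFour N).card * Real.log N + 4 * √N * Real.log N := by
    refine le_trans ?_ key
    refine mul_le_mul hyM ?_ (by positivity) (by positivity)
    linarith
  have h2 : y * (d / 2) ≤ 2 * (primesOneModFour N).card + 4 * √N :=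
    le_of_mul_le_mul_right (by linarith) hlogpos
  have h3 : √(N : ℝ) ≤ (N : ℝ) ^ (1 - 2 * d) := by
    rw [Real.sqrt_eq_rpow]
    exact Real.rpow_le_rpow_of_exponent_le (by linarith) hc2
  have h4 : y = (N : ℝ) ^ (1 - 2 * d) * (N : ℝ) ^ d := by
    rw [hy, ← Real.rpow_add hN0]
    ring_nf
  have h5 : 0 < (N : ℝ) ^ (1 - 2 * d) := by positivity
  rw [h4] at h2
  nlinarith

lemma tendsto_div_log_atTop : Tendsto (fun L : ℝ => L / Real.log L) atTop atTop := by
  have h := Real.tendsto_exp_div_pow_atTop 1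
  refine (h.comp Real.tendsto_log_atTop).congr' ?_
  filter_upwards [eventually_gt_atTop 0] with L hL
  simp [Real.exp_log hL]

/-- For every large `L` there are `k ≥ (1 - ε) L / log L - 1` primes congruent to `1` modulo `4`
whose product is at most `exp L`. -/
lemma eventually_exists_primes_prod_le_exp {ε : ℝ} (hε : 0 < ε) :
    ∀ᶠ L : ℝ in atTop, ∃ s : Finset ℕ, (∀ p ∈ s, p.Prime ∧ p % 4 = 1) ∧
      (1 - ε) * (L / Real.log L) - 1 ≤ s.card ∧ s.Nonempty ∧
      ((∏ p ∈ s, p : ℕ) : ℝ) ≤ Real.exp L := by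
  have hN : Tendsto (fun L : ℝ => ⌈L ^ (1 + ε / 2)⌉₊) atTop atTop :=
    tendsto_nat_ceil_atTop.comp (tendsto_rpow_atTop (by linarith))
  have hc : 1 / (1 + ε / 2) < 1 := by
    rw [div_lt_one (by linarith)]
    linarith
  filter_upwards [hN.eventually (eventually_rpow_le_card_primesOneModFour hc),
    (tendsto_rpow_atTop (by linarith : 0 < ε / 2)).eventually_ge_atTop 2,
    Real.tendsto_log_atTop.eventually_ge_atTop 1, eventually_ge_atTop 1,
    tendsto_div_log_atTop.eventually_ge_atTop (1 + ε)] with L hcard hpow hlog hL hQL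
  set N := ⌈L ^ (1 + ε / 2)⌉₊ with hNdef
  have hL0 : 0 < L := by linarith
  have hNle : L ^ (1 + ε / 2) ≤ N := Nat.le_ceil _
  have hone : 1 ≤ L ^ (1 + ε / 2) := Real.one_le_rpow hL (by linarith)
  have hN0 : (0 : ℝ) < N := by linarith
  have hlogN : Real.log N ≤ (1 + ε) * Real.log L := by
    rw [← Real.log_rpow hL0]
    refine Real.log_le_log hN0 ?_
    have h1 : L ^ (1 + ε) = L ^ (1 + ε / 2) * L ^ (ε / 2) := by
      rw [← Real.rpow_add hL0]
      ring_nf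
    have h2 := Nat.ceil_lt_add_one (by linarith : 0 ≤ L ^ (1 + ε / 2))
    rw [h1]
    nlinarith
  have hLcard : L ≤ (primesOneModFour N).card := by
    refine le_trans ?_ hcard
    calc L = (L ^ (1 + ε / 2)) ^ (1 / (1 + ε / 2)) := by
          rw [← Real.rpow_mul hL0.le, mul_one_div_cancel (by linarith), Real.rpow_one]
      _ ≤ _ := Real.rpow_le_rpow (by linarith) hNle (by positivity)
  have hD : 0 < (1 + ε) * Real.log L := by positivity
  set k := ⌊L / ((1 + ε) * Real.log L)⌋₊ with hk
  have hkle : (k : ℝ) ≤ L / ((1 + ε) * Real.log L) := Nat.floor_le (by positivity)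
  have hkL : k * ((1 + ε) * Real.log L) ≤ L := (le_div_iff₀ hD).mp hkle
  have hkcard : k ≤ (primesOneModFour N).card := by
    have : (k : ℝ) ≤ L := by
      refine hkle.trans (div_le_self hL0.le ?_)
      nlinarith
    exact_mod_cast this.trans hLcard
  obtain ⟨s, hs, hsk⟩ := Finset.exists_subset_card_eq hkcard
  have hsN : ∀ p ∈ s, p ≤ N ∧ p.Prime ∧ p % 4 = 1 := by
    intro p hp
    have := hs hp
    simp only [primesOneModFour, Finset.mem_filter, Finset.mem_Ioc] at this
    exact ⟨this.1.2, this.2⟩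
  refine ⟨s, fun p hp => (hsN p hp).2, ?_, ?_, ?_⟩
  · rw [hsk]
    have h1 : L / ((1 + ε) * Real.log L) < k + 1 := Nat.lt_floor_add_one _
    have h2 : (1 - ε) * (L / Real.log L) ≤ L / ((1 + ε) * Real.log L) := by
      rw [mul_comm (1 + ε), ← div_div, le_div_iff₀ (by linarith)]
      have : 0 < L / Real.log L := by positivity
      nlinarith [mul_pos (mul_pos hε hε) this]
    linarith
  · rw [← Finset.card_pos, hsk, hk, Nat.floor_pos, mul_comm, ← div_div, le_div_iff₀ (by linarith)]
    linarith
  · have h1 : ∏ p ∈ s, p ≤ N ^ k := by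
      rw [← hsk]
      exact Finset.prod_le_pow_card s (fun p => p) N fun p hp => (hsN p hp).1
    calc ((∏ p ∈ s, p : ℕ) : ℝ) ≤ (N : ℝ) ^ k := by exact_mod_cast h1
      _ = Real.exp (k * Real.log N) := by rw [Real.exp_nat_mul, Real.exp_log hN0]
      _ ≤ Real.exp L := by
        refine Real.exp_le_exp.mpr (le_trans ?_ hkL)
        exact mul_le_mul_of_nonneg_left hlogN (Nat.cast_nonneg k)

theorem stmt8 (ε : ℝ) (hε : 0 < ε) :
    ∃ x0 : ℕ, ∀ x : ℕ, x0 ≤ x →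
      Real.exp ((Real.log 2 - ε) * Real.log x / Real.log (Real.log x)) ≤
        (sS squares x : ℝ) := by
  have hlog : Tendsto (fun x : ℕ => Real.log x) atTop atTop :=
    Real.tendsto_log_atTop.comp tendsto_natCast_atTop_atTop
  have hlt : Real.log 2 < 1 := by linarith [Real.log_two_lt_d9]
  have hgt : 0 < Real.log 2 := Real.log_pos (by norm_num)
  refine eventually_atTop.mp ?_
  filter_upwards [hlog.eventually (eventually_exists_primes_prod_le_exp hε),
    (tendsto_div_log_atTop.comp hlog).eventually_ge_atTop (4 * Real.log 2 / (ε * (1 - Real.log 2))),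
    eventually_ge_atTop 1] with x hx hxQ hx1
  obtain ⟨s, hs, hcard, hne, hprod⟩ := hx
  simp only [Function.comp_apply] at hxQ
  rw [div_le_iff₀ (mul_pos hε (by linarith))] at hxQ
  rw [Real.exp_log (by exact_mod_cast hx1)] at hprod
  have h8 : (2 : ℝ) ^ s.card ≤ 8 * (sS squares x : ℝ) := by
    exact_mod_cast two_pow_le_eight_mul_sS_squares s hs hne (by exact_mod_cast hprod)
  have h2 : Real.exp (s.card * Real.log 2) = (2 : ℝ) ^ s.card := by
    rw [Real.exp_nat_mul, Real.exp_log (by norm_num)]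
  have h3 : Real.exp (3 * Real.log 2) = 8 := by
    rw [show (3 : ℝ) = (3 : ℕ) by norm_num, Real.exp_nat_mul, Real.exp_log (by norm_num)]
    norm_num
  have h4 : (Real.log 2 - ε) * Real.log x / Real.log (Real.log x) ≤
      s.card * Real.log 2 - 3 * Real.log 2 := by
    rw [mul_div_assoc]
    nlinarith
  calc _ ≤ Real.exp (s.card * Real.log 2 - 3 * Real.log 2) := Real.exp_le_exp.mpr h4
    _ = 2 ^ s.card / 8 := by rw [Real.exp_sub, h2, h3]
    _ ≤ _ := by linarith
end

section
/- Let C = {n³ : n ≥ 1} be the set of positive cubes. Then s_C(x) ≫ log log x; that is, there is a constant c > 0 such that for all sufficiently large x, there exists n ≤ x with at least c·log log x representations of n as a sum of two positive cubes. -/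
open Filter

/-- The set of positive cubes. -/
def cubes : Set ℕ := {m | ∃ n : ℕ, 1 ≤ n ∧ m = n ^ 3}

/-- `x³ + y³ = N z³` with `y, z` positive, `x / y ≥ c` and `x, z ≤ M`, for `p = (x, y, z)`. -/
def IsCubeSum (N M c : ℕ) (p : ℕ × ℕ × ℕ) : Prop :=
  0 < p.2.1 ∧ 0 < p.2.2 ∧ c * p.2.1 ≤ p.1 ∧ p.1 ^ 3 + p.2.1 ^ 3 = N * p.2.2 ^ 3 ∧
    p.1 ≤ M ∧ p.2.2 ≤ M

/-- Vieta's tangent step from a sum of two cubes to a difference of two cubes. -/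
lemma exists_cube_sub {N M c x y z : ℕ} (hc : 1 ≤ c) (hM : 3 ≤ M) (hy : 0 < y) (hz : 0 < z)
    (hxy : 8 * c * y ≤ x) (h : x ^ 3 + y ^ 3 = N * z ^ 3) (hx : x ≤ M) (hzM : z ≤ M) :
    ∃ X Y Z : ℕ, 0 < Y ∧ 0 < Z ∧ 4 * c * Y ≤ X ∧ X ^ 3 = Y ^ 3 + N * Z ^ 3 ∧
      X ≤ M ^ 5 ∧ Z ≤ M ^ 5 ∧ X * y ≤ x * Y := by
  have hyx : y < x := by nlinarith
  have hyx3 : y ^ 3 < x ^ 3 := Nat.pow_lt_pow_left hyx (by norm_num)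
  obtain ⟨e, hd⟩ := Nat.exists_eq_add_of_le hyx3.le
  have he : 0 < e := by omega
  have hx3 : x ^ 3 ≤ M ^ 3 := Nat.pow_le_pow_left hx 3
  have hM3 : 3 * M ^ 3 ≤ M * M ^ 3 := Nat.mul_le_mul_right _ hM
  refine ⟨x * (3 * y ^ 3 + e), y * (3 * y ^ 3 + 2 * e), z * e, by positivity, by positivity,
    ?_, ?_, ?_, ?_, ?_⟩
  · calc 4 * c * (y * (3 * y ^ 3 + 2 * e)) ≤ 8 * c * y * (3 * y ^ 3 + e) := by
          have : 0 ≤ c * y * y ^ 3 := Nat.zero_le _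
          nlinarith
      _ ≤ x * (3 * y ^ 3 + e) := Nat.mul_le_mul_right _ hxy
  · have h2 : N * z ^ 3 = 2 * y ^ 3 + e := by omega
    calc (x * (3 * y ^ 3 + e)) ^ 3 = x ^ 3 * (3 * y ^ 3 + e) ^ 3 := by ring
      _ = (y * (3 * y ^ 3 + 2 * e)) ^ 3 + (2 * y ^ 3 + e) * e ^ 3 := by rw [hd]; ring
      _ = _ := by rw [← h2]; ring
  · calc x * (3 * y ^ 3 + e) ≤ M * (M * M ^ 3) :=
          Nat.mul_le_mul hx (by omega)
      _ = M ^ 5 := by ring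
  · calc z * e ≤ M * (M * M ^ 3) := Nat.mul_le_mul hzM (by omega)
      _ = M ^ 5 := by ring
  · calc x * (3 * y ^ 3 + e) * y = x * (y * (3 * y ^ 3 + e)) := by ring
      _ ≤ _ := by gcongr; omega

/-- Vieta's tangent step from a difference of two cubes to a sum of two cubes. -/
lemma exists_cube_add {N M c X Y Z : ℕ} (hc : 1 ≤ c) (hM : 3 ≤ M) (hY : 0 < Y) (hZ : 0 < Z)
    (hXY : 4 * c * Y ≤ X) (h : X ^ 3 = Y ^ 3 + N * Z ^ 3) (hX : X ≤ M ^ 5) (hZM : Z ≤ M ^ 5) :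
    ∃ p, IsCubeSum N (M ^ 21) c p ∧ p.1 * Y < X * p.2.1 := by
  have hYX : 4 * Y ≤ X := by nlinarith
  have h4 : 64 * Y ^ 3 ≤ X ^ 3 := by
    calc 64 * Y ^ 3 = (4 * Y) ^ 3 := by ring
      _ ≤ X ^ 3 := Nat.pow_le_pow_left hYX 3
  have hY3 : 0 < Y ^ 3 := by positivity
  obtain ⟨e, he⟩ := Nat.exists_eq_add_of_le (show 2 * Y ^ 3 ≤ X ^ 3 by omega)
  have he0 : 0 < e := by omega
  have hX0 : 0 < X := by omega
  have hX3 : X ^ 3 ≤ M ^ 15 := by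
    calc X ^ 3 ≤ (M ^ 5) ^ 3 := Nat.pow_le_pow_left hX 3
      _ = M ^ 15 := by ring
  refine ⟨(X * e, Y * (3 * Y ^ 3 + 2 * e), Z * (3 * Y ^ 3 + e)), ⟨?_, ?_, ?_, ?_, ?_, ?_⟩, ?_⟩ <;>
    dsimp only
  · positivity
  · positivity
  · have h5 : 4 * c * Y * (3 * Y ^ 3 + 2 * e) ≤ X * (4 * e) :=
      Nat.mul_le_mul hXY (by omega)
    nlinarith
  · have h2 : N * Z ^ 3 = Y ^ 3 + e := by omega
    calc (X * e) ^ 3 + (Y * (3 * Y ^ 3 + 2 * e)) ^ 3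
        = X ^ 3 * e ^ 3 + (Y * (3 * Y ^ 3 + 2 * e)) ^ 3 := by ring
      _ = (Y ^ 3 + e) * (3 * Y ^ 3 + e) ^ 3 := by rw [he]; ring
      _ = _ := by rw [← h2]; ring
  · calc X * e ≤ M ^ 5 * (M * M ^ 15) := Nat.mul_le_mul hX (by nlinarith)
      _ = M ^ 21 := by ring
  · calc Z * (3 * Y ^ 3 + e) ≤ M ^ 5 * (M * M ^ 15) := Nat.mul_le_mul hZM (by nlinarith)
      _ = M ^ 21 := by ring
  · calc X * e * Y = X * (Y * e) := by ring
      _ < _ := by gcongr; omega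

/-- The quotient `x / y` of a triple `(x, y, z)`. -/
def tripleRatio (p : ℕ × ℕ × ℕ) : ℚ := p.1 / p.2.1

lemma IsCubeSum.exists_ratio_lt {N M c : ℕ} {p : ℕ × ℕ × ℕ} (hc : 1 ≤ c) (hM : 3 ≤ M)
    (hp : IsCubeSum N M (8 * c) p) :
    ∃ q, IsCubeSum N (M ^ 21) c q ∧ tripleRatio q < tripleRatio p := by
  obtain ⟨x, y, z⟩ := p
  obtain ⟨hy, hz, hxy, h, hx, hzM⟩ := hp
  dsimp only at hy hz hxy h hx hzM
  obtain ⟨X, Y, Z, hY, hZ, hXY, h', hX, hZM, hle⟩ := exists_cube_sub hc hM hy hz hxy h hx hzM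
  obtain ⟨q, hq, hlt⟩ := exists_cube_add hc hM hY hZ hXY h' hX hZM
  refine ⟨q, hq, ?_⟩
  have hq0 := hq.1
  have h1 : (q.1 : ℚ) / q.2.1 < X / Y := by
    rw [div_lt_div_iff₀ (by exact_mod_cast hq0) (by exact_mod_cast hY)]
    exact_mod_cast hlt
  have h2 : (X : ℚ) / Y ≤ x / y := by
    rw [div_le_div_iff₀ (by exact_mod_cast hY) (by exact_mod_cast hy)]
    exact_mod_cast hle
  exact h1.trans_le h2

lemma IsCubeSum.exists_seq {N : ℕ} (K : ℕ) {M : ℕ} {p : ℕ × ℕ × ℕ} (hM : 3 ≤ M)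
    (hp : IsCubeSum N M (8 ^ K) p) :
    ∃ f : ℕ → ℕ × ℕ × ℕ, f 0 = p ∧ (∀ k ≤ K, IsCubeSum N (M ^ 21 ^ k) 1 (f k)) ∧
      ∀ k < K, tripleRatio (f (k + 1)) < tripleRatio (f k) := by
  induction K generalizing M p with
  | zero => exact ⟨fun _ => p, rfl, by simpa using hp, by simp⟩
  | succ K ih =>
    rw [pow_succ'] at hp
    obtain ⟨q, hq, hlt⟩ := hp.exists_ratio_lt (Nat.one_le_pow _ _ (by norm_num)) hM
    obtain ⟨f, rfl, hf, hlt'⟩ := ih (hM.trans (Nat.le_self_pow (by norm_num) M)) hq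
    refine ⟨fun k => Nat.casesOn k p f, rfl, ?_, ?_⟩
    · rintro (_ | k) hk
      · obtain ⟨hy, hz, hxy, h⟩ := hp
        refine ⟨hy, hz, le_trans (Nat.mul_le_mul_right _ ?_) hxy, by simpa using h⟩
        exact Nat.mul_pos (by norm_num) (by positivity)
      · have := hf k (by omega)
        rwa [← pow_mul, ← pow_succ'] at this
    · rintro (_ | k) hk
      · exact hlt
      · exact hlt' k (by omega)

lemma finite_representations (A : Set ℕ) (n : ℕ) :
    Finite {p : ℕ × ℕ // p.1 ∈ A ∧ p.2 ∈ A ∧ p.1 ≤ p.2 ∧ p.1 + p.2 = n} := by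
  refine Set.Finite.to_subtype ((Set.finite_Iic (n, n)).subset ?_)
  rintro ⟨a, b⟩ ⟨-, -, -, h⟩
  dsimp only at h
  exact ⟨by dsimp only; omega, by dsimp only; omega⟩

lemma le_RS_cubes {N K : ℕ} {M : ℕ → ℕ} {f : ℕ → ℕ × ℕ × ℕ}
    (hf : ∀ k < K, IsCubeSum N (M k) 1 (f k)) (hinj : Set.InjOn (tripleRatio ∘ f) (Set.Iio K)) :
    K ≤ RS cubes (N * (∏ k ∈ Finset.range K, (f k).2.2) ^ 3) := by
  have := finite_representations cubes (N * (∏ k ∈ Finset.range K, (f k).2.2) ^ 3)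
  set w : ℕ → ℕ := fun k => ∏ j ∈ (Finset.range K).erase k, (f j).2.2
  have hw0 (k : ℕ) : 0 < w k := Finset.prod_pos fun j hj =>
    (hf j (Finset.mem_range.1 (Finset.mem_of_mem_erase hj))).2.1
  have hprod (k : ℕ) (hk : k < K) : (f k).2.2 * w k = ∏ k ∈ Finset.range K, (f k).2.2 :=
    Finset.mul_prod_erase _ (fun k => (f k).2.2) (Finset.mem_range.2 hk)
  let g : Fin K → {p : ℕ × ℕ // p.1 ∈ cubes ∧ p.2 ∈ cubes ∧ p.1 ≤ p.2 ∧
      p.1 + p.2 = N * (∏ k ∈ Finset.range K, (f k).2.2) ^ 3} := fun k =>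
    ⟨(((f k).2.1 * w k) ^ 3, ((f k).1 * w k) ^ 3), by
      obtain ⟨hy, hz, hxy, h, -⟩ := hf k k.2
      rw [one_mul] at hxy
      refine ⟨⟨_, Nat.mul_pos hy (hw0 k), rfl⟩, ⟨_, Nat.mul_pos (hy.trans_le hxy) (hw0 k), rfl⟩,
        Nat.pow_le_pow_left (Nat.mul_le_mul_right _ hxy) 3, ?_⟩
      rw [← hprod k k.2, mul_pow, mul_pow, mul_pow, ← mul_assoc, ← h]
      ring⟩
  have hg : Function.Injective g := by
    intro i j hij
    have hij' := Prod.ext_iff.1 (Subtype.ext_iff.1 hij)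
    have h1 : (f i).2.1 * w i = (f j).2.1 * w j := Nat.pow_left_injective (by norm_num) hij'.1
    have h2 : (f i).1 * w i = (f j).1 * w j := Nat.pow_left_injective (by norm_num) hij'.2
    refine Fin.ext (hinj i.2 j.2 ?_)
    have key (k : ℕ) : tripleRatio (f k) = ((f k).1 * w k : ℕ) / ((f k).2.1 * w k : ℕ) := by
      have : (w k : ℚ) ≠ 0 := by exact_mod_cast (hw0 k).ne'
      push_cast
      rw [mul_div_mul_right _ _ this]
      rfl
    simp only [Function.comp_apply, key, h1, h2]
  simpa [RS] using Nat.card_le_card_of_injective g hg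

lemma exists_le_RS_cubes (K : ℕ) : ∃ n ≤ 8 ^ ((K + 1) * (7 * 21 ^ K)), K ≤ RS cubes n := by
  set A := 8 ^ (K + 1) with hA
  have hA8 : 8 ≤ A := Nat.le_self_pow (by omega) 8
  have h0 : IsCubeSum (A ^ 3 + 1) A (8 ^ K) (A, 1, 1) :=
    ⟨one_pos, one_pos, by simpa [hA] using Nat.pow_le_pow_right (by norm_num) K.le_succ,
      by simp, le_rfl, by dsimp only; omega⟩
  obtain ⟨f, -, hf, hlt⟩ := h0.exists_seq K (by omega)
  have hanti : StrictAntiOn (tripleRatio ∘ f) (Set.Iic K) :=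
    strictAntiOn_of_add_one_lt Set.ordConnected_Iic fun k _ _ hk => hlt k hk
  refine ⟨_, ?_, le_RS_cubes (M := fun k => A ^ 21 ^ k) (fun k hk => hf k hk.le)
    (hanti.injOn.mono Set.Iio_subset_Iic_self)⟩
  have hprod : ∏ k ∈ Finset.range K, (f k).2.2 ≤ A ^ 21 ^ K := by
    calc ∏ k ∈ Finset.range K, (f k).2.2 ≤ ∏ k ∈ Finset.range K, A ^ 21 ^ k :=
          Finset.prod_le_prod' fun k hk => (hf k (Finset.mem_range.1 hk).le).2.2.2.2.2
      _ = A ^ ∑ k ∈ Finset.range K, 21 ^ k := Finset.prod_pow_eq_pow_sum _ _ _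
      _ ≤ A ^ 21 ^ K := Nat.pow_le_pow_right (by omega)
          (Nat.geomSum_lt (by norm_num) fun k hk => Finset.mem_range.1 hk).le
  calc (A ^ 3 + 1) * (∏ k ∈ Finset.range K, (f k).2.2) ^ 3
      ≤ A ^ 4 * (A ^ 21 ^ K) ^ 3 := by
        gcongr
        have : 0 < A ^ 3 := by positivity
        calc A ^ 3 + 1 ≤ A ^ 3 * 8 := by omega
          _ ≤ A ^ 3 * A := by gcongr
          _ = A ^ 4 := by ring
    _ = A ^ (4 + 3 * 21 ^ K) := by rw [← pow_mul A, ← pow_add, mul_comm 3]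
    _ ≤ A ^ (7 * 21 ^ K) := by
        have : 0 < 21 ^ K := by positivity
        exact Nat.pow_le_pow_right (by omega) (by omega)
    _ = 8 ^ ((K + 1) * (7 * 21 ^ K)) := by rw [hA, ← pow_mul]

lemma eight_pow_le_exp_exp (K : ℕ) :
    ((8 ^ ((K + 1) * (7 * 21 ^ K)) : ℕ) : ℝ) ≤ Real.exp (Real.exp (4 * (K + 1))) := by
  have he : (2.7 : ℝ) ≤ Real.exp 1 := by linarith [Real.exp_one_gt_d9]
  have h8 : (8 : ℝ) ≤ Real.exp 3 := by
    calc (8 : ℝ) ≤ 2.7 ^ 3 := by norm_num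
      _ ≤ Real.exp 1 ^ 3 := by gcongr
      _ = Real.exp 3 := by rw [← Real.exp_nat_mul]; norm_num
  have h42 : (42 : ℝ) ≤ Real.exp 4 := by
    calc (42 : ℝ) ≤ 2.7 ^ 4 := by norm_num
      _ ≤ Real.exp 1 ^ 4 := by gcongr
      _ = Real.exp 4 := by rw [← Real.exp_nat_mul]; norm_num
  have hK : ((K : ℝ) + 1) ≤ 2 ^ K := by exact_mod_cast K.lt_two_pow_self
  push_cast
  calc (8 : ℝ) ^ ((K + 1) * (7 * 21 ^ K)) ≤ Real.exp 3 ^ ((K + 1) * (7 * 21 ^ K)) := by gcongr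
    _ = Real.exp ((K + 1) * (21 * 21 ^ K)) := by
        rw [← Real.exp_nat_mul]
        push_cast
        congr 1
        ring
    _ ≤ Real.exp (Real.exp (4 * (K + 1))) := by
        gcongr
        calc ((K : ℝ) + 1) * (21 * 21 ^ K) ≤ 2 ^ K * (42 * 21 ^ K) := by
              gcongr
              norm_num
          _ = 42 ^ (K + 1) := by
              rw [pow_succ, show (42 : ℝ) ^ K = 2 ^ K * 21 ^ K by rw [← mul_pow]; norm_num]
              ring
          _ ≤ Real.exp 4 ^ (K + 1) := by gcongr
          _ = Real.exp (4 * (K + 1)) := by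
              rw [← Real.exp_nat_mul]
              push_cast
              rw [mul_comm]

theorem stmt11 :
    ∃ c : ℝ, 0 < c ∧ ∀ᶠ x : ℕ in atTop,
      c * Real.log (Real.log x) ≤ (sS cubes x : ℝ) := by
  have hlim : Tendsto (fun x : ℕ => Real.log (Real.log x)) atTop atTop :=
    Real.tendsto_log_atTop.comp (Real.tendsto_log_atTop.comp tendsto_natCast_atTop_atTop)
  refine ⟨1 / 8, by norm_num, ?_⟩
  filter_upwards [hlim.eventually_ge_atTop 16, eventually_gt_atTop 1] with x hL hx
  set L := Real.log (Real.log x) with hLdef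
  obtain ⟨n, hn, hRS⟩ := exists_le_RS_cubes ⌈L / 8⌉₊
  have hceil : (⌈L / 8⌉₊ : ℝ) < L / 8 + 1 := Nat.ceil_lt_add_one (by linarith)
  have hx1 : (1 : ℝ) < x := by exact_mod_cast hx
  have hnx : n ≤ x := by
    have : (n : ℝ) ≤ x := by
      calc (n : ℝ) ≤ Real.exp (Real.exp (4 * (⌈L / 8⌉₊ + 1))) :=
            le_trans (by exact_mod_cast hn) (eight_pow_le_exp_exp _)
        _ ≤ Real.exp (Real.exp L) := by
            gcongr
            linarith
        _ = x := by rw [hLdef, Real.exp_log (Real.log_pos hx1), Real.exp_log (by linarith)]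
    exact_mod_cast this
  have hs : ⌈L / 8⌉₊ ≤ sS cubes x :=
    hRS.trans (Finset.le_sup (f := RS cubes) (Finset.mem_range.2 (Nat.lt_succ_of_le hnx)))
  calc 1 / 8 * L = L / 8 := by ring
    _ ≤ ⌈L / 8⌉₊ := Nat.le_ceil _
    _ ≤ sS cubes x := by exact_mod_cast hs
end

section
/- If A = {a_1 < a_2 < ...} ⊆ ℕ satisfies a_n = n³ + o(log log n), then the representation function R_A(n) (number of ways to write n = a_i + a_j, i ≤ j) is unbounded. -/
open Filter

/-- Two tangent steps on the curve `X ^ 3 + Y ^ 3 = N` turn a point whose coordinates have a large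
ratio into another point with positive coordinates, of a slightly smaller ratio. -/
theorem exists_tangent_step (x y : ℤ) (hy : 0 < y) (hxy : 4 * y ≤ x) :
    ∃ x' y' d : ℤ, 0 < y' ∧ 0 < x' ∧ 0 < d ∧ x' ^ 3 + y' ^ 3 = (x ^ 3 + y ^ 3) * d ^ 3 ∧
      y * x' < y' * x ∧ y' * x ≤ 6 * (y * x') ∧ x' ≤ 81 * x ^ 16 := by
  have hx : 0 < x := by linarith
  have hyx3 : y ^ 3 < x ^ 3 := pow_lt_pow_left₀ (by linarith) hy.le (by norm_num)
  have hy3 : 0 < y ^ 3 := by positivity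
  obtain ⟨X, hX⟩ : ∃ X, X = x * (x ^ 3 + 2 * y ^ 3) := ⟨_, rfl⟩
  obtain ⟨Y, hY⟩ : ∃ Y, Y = y * (2 * x ^ 3 + y ^ 3) := ⟨_, rfl⟩
  have hX0 : 0 < X := by rw [hX]; positivity
  have hY0 : 0 < Y := by rw [hY]; positivity
  have hlow : y * X < Y * x := by
    have : 0 < x * y * (x ^ 3 - y ^ 3) := by
      have : 0 < x ^ 3 - y ^ 3 := by linarith
      positivity
    rw [hX, hY]; linarith
  have hupp : Y * x ≤ 2 * (y * X) := by
    have : 0 < x * y * y ^ 3 := by positivity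
    rw [hX, hY]; linarith
  have hYX : 2 * Y ≤ X := by
    have h : (2 * Y) * x ≤ X * x := by
      have := mul_le_mul_of_nonneg_right hxy hX0.le
      linarith
    exact le_of_mul_le_mul_right h hx
  have hQP : 8 * Y ^ 3 ≤ X ^ 3 := by
    have := pow_le_pow_left₀ (by linarith) hYX 3
    linarith [mul_pow 2 Y 3]
  have hQ : 0 < Y ^ 3 := by positivity
  have hP : 0 < X ^ 3 := by positivity
  have hA : 0 < X ^ 3 - 2 * Y ^ 3 := by linarith
  have hB : X ^ 3 - 2 * Y ^ 3 < 2 * X ^ 3 - Y ^ 3 := by linarith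
  have hC : 2 * X ^ 3 - Y ^ 3 ≤ 3 * (X ^ 3 - 2 * Y ^ 3) := by linarith
  refine ⟨X * (X ^ 3 - 2 * Y ^ 3), Y * (2 * X ^ 3 - Y ^ 3),
    (x ^ 3 - y ^ 3) * (X ^ 3 + Y ^ 3), ?_, ?_, ?_, ?_, ?_, ?_, ?_⟩
  · exact mul_pos hY0 (by linarith)
  · exact mul_pos hX0 hA
  · exact mul_pos (by linarith) (by linarith)
  · have h₁ : X ^ 3 - Y ^ 3 = (x ^ 3 + y ^ 3) * (x ^ 3 - y ^ 3) ^ 3 := by rw [hX, hY]; ring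
    have h₂ : (X * (X ^ 3 - 2 * Y ^ 3)) ^ 3 + (Y * (2 * X ^ 3 - Y ^ 3)) ^ 3 =
        (X ^ 3 - Y ^ 3) * (X ^ 3 + Y ^ 3) ^ 3 := by ring
    rw [h₂, h₁]; ring
  · calc y * (X * (X ^ 3 - 2 * Y ^ 3)) = (y * X) * (X ^ 3 - 2 * Y ^ 3) := by ring
      _ < (Y * x) * (2 * X ^ 3 - Y ^ 3) := by
        apply mul_lt_mul'' hlow hB <;> positivity
      _ = _ := by ring
  · calc Y * (2 * X ^ 3 - Y ^ 3) * x = (Y * x) * (2 * X ^ 3 - Y ^ 3) := by ring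
      _ ≤ (2 * (y * X)) * (3 * (X ^ 3 - 2 * Y ^ 3)) :=
        mul_le_mul hupp hC (by linarith) (by positivity)
      _ = _ := by ring
  · have hX3 : X ≤ 3 * x ^ 4 := by
      have := mul_le_mul_of_nonneg_left hyx3.le hx.le
      rw [hX]; linarith [show x * x ^ 3 = x ^ 4 by ring]
    calc X * (X ^ 3 - 2 * Y ^ 3) ≤ X * X ^ 3 :=
          mul_le_mul_of_nonneg_left (by linarith) hX0.le
      _ = X ^ 4 := by ring
      _ ≤ (3 * x ^ 4) ^ 4 := pow_le_pow_left₀ hX0.le hX3 4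
      _ = _ := by ring

/-- Iterating the tangent step: a multiple of `x ^ 3 + y ^ 3` by a cube that has `k + 1` different
representations as a sum of two positive cubes. -/
theorem exists_many_sum_two_cubes (k : ℕ) (x y : ℤ) (hy : 0 < y) (hxy : 4 * 6 ^ k * y ≤ x) :
    ∃ (S : Finset (ℤ × ℤ)) (m : ℤ), 0 < m ∧ S.card = k + 1 ∧
      (∀ p ∈ S, 0 < p.2 ∧ p.2 < p.1 ∧ p.1 ^ 3 + p.2 ^ 3 = (x ^ 3 + y ^ 3) * m ^ 3 ∧
        y * p.1 ≤ p.2 * x) ∧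
      (x ^ 3 + y ^ 3) * m ^ 3 ≤ 2 * (81 * x) ^ (3 * 16 ^ k) := by
  induction k generalizing x y with
  | zero =>
    have hx : 0 < x := by linarith
    refine ⟨{(x, y)}, 1, one_pos, by simp, ?_, ?_⟩
    · simp only [Finset.mem_singleton, forall_eq]
      exact ⟨hy, by linarith, by ring, le_refl _⟩
    · have h₁ : y ^ 3 ≤ x ^ 3 := pow_le_pow_left₀ hy.le (by linarith) 3
      have h₂ : 0 < x ^ 3 := by positivity
      have h₃ : (81 * x) ^ 3 = 531441 * x ^ 3 := by ring
      simp only [pow_zero, mul_one, one_pow, h₃]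
      linarith
  | succ k ih =>
    have h4 : 4 * y ≤ x := by
      have : 1 * y ≤ 6 ^ (k + 1) * y :=
        mul_le_mul_of_nonneg_right (one_le_pow₀ (by norm_num)) hy.le
      linarith
    have hx : 0 < x := by linarith
    obtain ⟨x', y', d, hy', hx', hd, heq, hlow, hupp, hsize⟩ := exists_tangent_step x y hy h4
    have hxy' : 4 * 6 ^ k * y' ≤ x' := by
      have h : (4 * 6 ^ k * y') * x ≤ x' * x := by
        calc (4 * 6 ^ k * y') * x = 4 * 6 ^ k * (y' * x) := by ring
          _ ≤ 4 * 6 ^ k * (6 * (y * x')) := by gcongr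
          _ = (4 * 6 ^ (k + 1) * y) * x' := by ring
          _ ≤ x * x' := by gcongr
          _ = x' * x := by ring
      exact le_of_mul_le_mul_right h hx
    obtain ⟨S, m, hm, hcard, hS, hbound⟩ := ih x' y' hy' hxy'
    have hcube : (x ^ 3 + y ^ 3) * (d * m) ^ 3 = (x' ^ 3 + y' ^ 3) * m ^ 3 := by rw [heq]; ring
    have hdm : 0 < d * m := by positivity
    have hnot : (x * (d * m), y * (d * m)) ∉ S := by
      intro h
      have h₁ := (hS _ h).2.2.2
      have h₂ := mul_lt_mul_of_pos_right hlow hdm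
      simp only at h₁
      linarith
    refine ⟨insert (x * (d * m), y * (d * m)) S, d * m, hdm, ?_, ?_, ?_⟩
    · rw [Finset.card_insert_of_notMem hnot, hcard]
    · intro p hp
      rcases Finset.mem_insert.1 hp with rfl | hp
      · refine ⟨by positivity, ?_, by ring, le_of_eq (by ring)⟩
        exact mul_lt_mul_of_pos_right (by linarith) hdm
      · obtain ⟨h₁, h₂, h₃, h₄⟩ := hS p hp
        refine ⟨h₁, h₂, by rw [h₃, hcube], ?_⟩
        have h : (y * p.1) * x' ≤ (p.2 * x) * x' := by
          calc (y * p.1) * x' = (y * x') * p.1 := by ring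
            _ ≤ (y' * x) * p.1 := mul_le_mul_of_nonneg_right hlow.le (by linarith)
            _ = (y' * p.1) * x := by ring
            _ ≤ (p.2 * x') * x := mul_le_mul_of_nonneg_right h₄ hx.le
            _ = (p.2 * x) * x' := by ring
        exact le_of_mul_le_mul_right h hx'
    · rw [hcube]
      refine hbound.trans ?_
      have h : 81 * x' ≤ (81 * x) ^ 16 := by
        have : 0 < x ^ 16 := by positivity
        rw [mul_pow]
        linarith
      calc 2 * (81 * x') ^ (3 * 16 ^ k) ≤ 2 * ((81 * x) ^ 16) ^ (3 * 16 ^ k) := by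
            gcongr
        _ = 2 * (81 * x) ^ (3 * 16 ^ (k + 1)) := by rw [← pow_mul]; congr 2; ring

/-- Numbers with `k + 1` representations as a sum of two positive cubes occur below a bound doubly
exponential in `k`. -/
theorem exists_sum_two_cubes_le (k : ℕ) :
    ∃ (S : Finset (ℕ × ℕ)) (N : ℕ), S.card = k + 1 ∧ 4 ≤ N ∧ N ≤ 6 ^ 32 ^ (k + 1) ∧
      ∀ p ∈ S, 0 < p.2 ∧ p.2 < p.1 ∧ p.1 ^ 3 + p.2 ^ 3 = N := by
  obtain ⟨S, m, hm, hcard, hS, hbound⟩ :=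
    exists_many_sum_two_cubes k (4 * 6 ^ k) 1 one_pos (by simp)
  obtain ⟨n, hn⟩ : ∃ n : ℤ, n = ((4 * 6 ^ k) ^ 3 + 1 ^ 3) * m ^ 3 := ⟨_, rfl⟩
  rw [← hn] at hbound
  simp only [← hn] at hS
  have hn4 : 4 ≤ n := by
    have h₁ : (1 : ℤ) ≤ 6 ^ k := one_le_pow₀ (by norm_num)
    have h₂ : (1 : ℤ) ≤ (6 ^ k) ^ 3 := one_le_pow₀ h₁
    have h₃ : (1 : ℤ) ≤ m ^ 3 := one_le_pow₀ hm
    rw [hn, mul_pow]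
    nlinarith
  refine ⟨S.image fun p => (p.1.toNat, p.2.toNat), n.toNat, ?_, by omega, ?_, ?_⟩
  · rw [Finset.card_image_of_injOn, hcard]
    intro p hp q hq h
    have h₁ := hS p hp
    have h₂ := hS q hq
    simp only [Prod.mk.injEq] at h
    ext <;> omega
  · have hk : k + 4 ≤ 4 * 2 ^ k := by
      have := Nat.lt_two_pow_self (n := k)
      have := Nat.one_le_two_pow (n := k)
      omega
    have hexp : 1 + (k + 4) * (3 * 16 ^ k) ≤ 32 ^ (k + 1) := by
      have h₁ : (32 : ℕ) ^ k = 2 ^ k * 16 ^ k := by rw [← mul_pow]; norm_num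
      have h₂ : 1 ≤ 32 ^ k := Nat.one_le_pow _ _ (by norm_num)
      have h₃ := Nat.mul_le_mul_right (3 * 16 ^ k) hk
      rw [pow_succ]
      linarith
    have h : n ≤ 6 ^ 32 ^ (k + 1) := by
      calc n ≤ 2 * (81 * (4 * 6 ^ k)) ^ (3 * 16 ^ k) := hbound
        _ ≤ 6 * (6 ^ (k + 4)) ^ (3 * 16 ^ k) := by
          have h₁ : (81 * (4 * 6 ^ k) : ℤ) ≤ 6 ^ (k + 4) := by
            have : (0 : ℤ) < 6 ^ k := by positivity
            rw [pow_add]; linarith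
          gcongr
          norm_num
        _ = 6 ^ (1 + (k + 4) * (3 * 16 ^ k)) := by rw [← pow_mul, pow_add, pow_one]
        _ ≤ 6 ^ 32 ^ (k + 1) := pow_le_pow_right₀ (by norm_num) hexp
    rw [Int.toNat_le]
    exact_mod_cast h
  · intro p hp
    obtain ⟨q, hq, rfl⟩ := Finset.mem_image.1 hp
    obtain ⟨h₁, h₂, h₃, -⟩ := hS q hq
    refine ⟨by simp only; omega, by simp only; omega, ?_⟩
    zify
    rw [Int.toNat_of_nonneg (by omega), Int.toNat_of_nonneg (by omega),
      Int.toNat_of_nonneg (by omega), h₃]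

/-- A double logarithm bound for numbers of doubly exponential size. -/
theorem log_log_le_of_le_pow_pow {N k : ℕ} (hN : 4 ≤ N) (h : N ≤ 6 ^ 32 ^ (k + 1)) :
    Real.log (Real.log N) ≤ 5 * (k + 1) := by
  have hN' : (4 : ℝ) ≤ N := by exact_mod_cast hN
  have hlog : 0 < Real.log N := Real.log_pos (by linarith)
  have h6 : 0 < Real.log 6 := Real.log_pos (by norm_num)
  have h₁ : Real.log N ≤ 32 ^ (k + 1) * Real.log 6 := by
    have : (N : ℝ) ≤ 6 ^ 32 ^ (k + 1) := by exact_mod_cast h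
    have := Real.log_le_log (by linarith) this
    rwa [Real.log_pow, Nat.cast_pow, Nat.cast_ofNat] at this
  have h₂ := Real.log_le_log hlog h₁
  rw [Real.log_mul (by positivity) h6.ne', Real.log_pow] at h₂
  have h2 := Real.log_two_lt_d9
  have h8 : Real.log 6 ≤ 2.1 := by
    have := Real.log_le_log (by norm_num) (show (6 : ℝ) ≤ 2 ^ 3 by norm_num)
    rw [Real.log_pow] at this
    push_cast at this
    linarith
  have h66 : Real.log (Real.log 6) ≤ 1.1 := by
    have := Real.log_le_sub_one_of_pos h6
    linarith
  have hk : (0 : ℝ) ≤ k := k.cast_nonneg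
  have h₃ : ((k + 1 : ℕ) : ℝ) * Real.log 32 ≤ (k + 1) * 3.6 := by
    push_cast
    gcongr
    rw [show (32 : ℝ) = 2 ^ 5 by norm_num, Real.log_pow]
    push_cast
    linarith
  linarith

/-- Distinct index pairs with the same sum give distinct representations. -/
theorem card_le_RS (a : ℕ → ℕ) (ha : ∀ m n, 1 ≤ m → m < n → a m < a n) (n : ℕ)
    (S : Finset (ℕ × ℕ)) (hS : ∀ p ∈ S, 0 < p.2 ∧ p.2 < p.1 ∧ a p.1 + a p.2 = n) :
    S.card ≤ RS (a '' Set.Ici 1) n := by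
  have hinj : ∀ i j, 1 ≤ i → 1 ≤ j → a i = a j → i = j := by
    intro i j hi hj h
    rcases lt_trichotomy i j with hij | hij | hij
    · exact absurd h (ha i j hi hij).ne
    · exact hij
    · exact absurd h (ha j i hj hij).ne'
  let T : Set (ℕ × ℕ) :=
    {p | p.1 ∈ a '' Set.Ici 1 ∧ p.2 ∈ a '' Set.Ici 1 ∧ p.1 ≤ p.2 ∧ p.1 + p.2 = n}
  have hT : T.Finite := by
    refine (Set.finite_Iic (n, n)).subset fun p hp => ?_
    have := hp.2.2.2
    exact ⟨by simp only; omega, by simp only; omega⟩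
  have hcard : (S.image fun p => (a p.2, a p.1)).card = S.card := by
    refine Finset.card_image_of_injOn fun p hp q hq h => ?_
    have h₁ := hS p hp
    have h₂ := hS q hq
    simp only [Prod.mk.injEq] at h
    exact Prod.ext (hinj _ _ (by omega) (by omega) h.2) (hinj _ _ (by omega) (by omega) h.1)
  rw [← hcard, ← Set.ncard_coe_finset]
  refine Set.ncard_le_ncard (t := T) (fun p hp => ?_) hT
  obtain ⟨q, hq, rfl⟩ := Finset.mem_image.1 (Finset.mem_coe.1 hp)
  obtain ⟨h₁, h₂, h₃⟩ := hS q hq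
  exact ⟨⟨q.2, h₁, rfl⟩, ⟨q.1, show 1 ≤ q.1 by omega, rfl⟩, (ha _ _ h₁ h₂).le,
    by simp only; omega⟩

/-- An eventual bound by `ε log log n` is uniform over `n ≤ N`, up to an additive constant. -/
theorem exists_forall_le_add_log_log {f : ℕ → ℝ} {ε : ℝ} (hε : 0 < ε)
    (hf : ∀ᶠ n : ℕ in atTop, f n ≤ ε * Real.log (Real.log n)) :
    ∃ C : ℝ, ∀ N : ℕ, 4 ≤ N → ∀ n ≤ N, f n ≤ C + ε * Real.log (Real.log N) := by
  obtain ⟨n₀, hn₀⟩ := eventually_atTop.1 hf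
  obtain ⟨C, hC⟩ := ((Finset.range (n₀ + 4)).image f).bddAbove
  have hlog : ∀ n : ℕ, 4 ≤ n → 1 ≤ Real.log n := by
    intro n hn
    have hn' : (4 : ℝ) ≤ n := by exact_mod_cast hn
    rw [Real.le_log_iff_exp_le (by linarith)]
    linarith [Real.exp_one_lt_d9]
  refine ⟨max C 0, fun N hN n hn => ?_⟩
  by_cases h : n < n₀ + 4
  · have h₁ : f n ≤ C := hC (by simpa using ⟨n, h, rfl⟩)
    have h₂ : 0 ≤ ε * Real.log (Real.log N) :=
      mul_nonneg hε.le (Real.log_nonneg (hlog N hN))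
    linarith [le_max_left C 0]
  · have h₁ := hn₀ n (by omega)
    have h₂ := hlog n (by omega)
    have hnpos : (0 : ℝ) < n := by exact_mod_cast (by omega : 0 < n)
    have h₃ : Real.log (Real.log n) ≤ Real.log (Real.log N) :=
      Real.log_le_log (by linarith) (Real.log_le_log hnpos (by exact_mod_cast hn))
    have h₄ := mul_le_mul_of_nonneg_left h₃ hε.le
    linarith [le_max_right C 0]

theorem stmt16 (a : ℕ → ℕ)
    (ha : ∀ m n, 1 ≤ m → m < n → a m < a n)
    (hsmall : ∀ ε : ℝ, 0 < ε → ∀ᶠ n : ℕ in atTop,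
      |(a n : ℝ) - (n : ℝ) ^ 3| ≤ ε * Real.log (Real.log n)) :
    ∀ M : ℕ, ∃ n : ℕ, M < RS (a '' Set.Ici 1) n := by
  intro M
  have hε : (0 : ℝ) < 1 / (40 * (M + 1)) := by positivity
  obtain ⟨C, hC⟩ := exists_forall_le_add_log_log hε (hsmall _ hε)
  obtain ⟨k, hk⟩ := exists_nat_gt (2 * M * (4 * C + 1))
  obtain ⟨S, N, hcard, hN, hNk, hS⟩ := exists_sum_two_cubes_le k
  have hL := log_log_le_of_le_pow_pow hN hNk
  obtain ⟨E, hE⟩ : ∃ E : ℝ, E = C + 1 / (40 * (M + 1)) * Real.log (Real.log N) := ⟨_, rfl⟩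
  have herr : ∀ n ≤ N, |(a n : ℝ) - (n : ℝ) ^ 3| ≤ E := fun n hn => hE ▸ hC N hN n hn
  have hE0 : 0 ≤ E := (abs_nonneg _).trans (herr 0 N.zero_le)
  have hmaps : ∀ p ∈ S, a p.1 + a p.2 ∈ Finset.Icc (N - ⌊2 * E⌋₊) (N + ⌊2 * E⌋₊) := by
    intro p hp
    obtain ⟨-, -, hsum⟩ := hS p hp
    have h₁ : p.1 ≤ N := (Nat.le_self_pow three_ne_zero _).trans (by omega)
    have h₂ : p.2 ≤ N := (Nat.le_self_pow three_ne_zero _).trans (by omega)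
    have e₁ := abs_le.1 (herr _ h₁)
    have e₂ := abs_le.1 (herr _ h₂)
    have hsum' : (p.1 : ℝ) ^ 3 + (p.2 : ℝ) ^ 3 = N := by exact_mod_cast hsum
    have hup : a p.1 + a p.2 - N ≤ ⌊2 * E⌋₊ := by
      refine Nat.le_floor ?_
      rcases le_total N (a p.1 + a p.2) with h | h
      · rw [Nat.cast_sub h]; push_cast; linarith
      · rw [Nat.sub_eq_zero_of_le h, Nat.cast_zero]; linarith
    have hdown : N - (a p.1 + a p.2) ≤ ⌊2 * E⌋₊ := by
      refine Nat.le_floor ?_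
      rcases le_total (a p.1 + a p.2) N with h | h
      · rw [Nat.cast_sub h]; push_cast; linarith
      · rw [Nat.sub_eq_zero_of_le h, Nat.cast_zero]; linarith
    rw [Finset.mem_Icc]
    omega
  have hlt : (Finset.Icc (N - ⌊2 * E⌋₊) (N + ⌊2 * E⌋₊)).card * M < S.card := by
    have h₁ : (Finset.Icc (N - ⌊2 * E⌋₊) (N + ⌊2 * E⌋₊)).card ≤ 2 * ⌊2 * E⌋₊ + 1 := by
      rw [Nat.card_Icc]; omega
    refine (Nat.mul_le_mul_right M h₁).trans_lt ?_
    rw [hcard, ← Nat.cast_lt (α := ℝ)]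
    push_cast
    have hfloor : (⌊2 * E⌋₊ : ℝ) ≤ 2 * E := Nat.floor_le (by linarith)
    have hM : (0 : ℝ) ≤ M := M.cast_nonneg
    have hk0 : (0 : ℝ) ≤ k := k.cast_nonneg
    have hEM : E * M ≤ C * M + (k + 1) / 8 := by
      have h₂ : E ≤ C + 1 / (40 * (M + 1)) * (5 * (k + 1)) := by rw [hE]; gcongr
      have h₃ : 1 / (40 * ((M : ℝ) + 1)) * (5 * (k + 1)) * M ≤ (k + 1) / 8 := by
        have : (M : ℝ) / (M + 1) ≤ 1 := (div_le_one (by linarith)).2 (by linarith)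
        calc 1 / (40 * ((M : ℝ) + 1)) * (5 * (k + 1)) * M
            = (k + 1) / 8 * (M / (M + 1)) := by field_simp; ring
          _ ≤ (k + 1) / 8 * 1 := by gcongr
          _ = _ := mul_one _
      have := mul_le_mul_of_nonneg_right h₂ hM
      linarith
    have := mul_le_mul_of_nonneg_right hfloor hM
    linarith
  obtain ⟨n, -, hn⟩ := Finset.exists_lt_card_fiber_of_mul_lt_card_of_maps_to hmaps hlt
  refine ⟨n, hn.trans_le (card_le_RS a ha n _ fun p hp => ?_)⟩
  obtain ⟨hp, hpn⟩ := Finset.mem_filter.1 hp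
  obtain ⟨h₁, h₂, -⟩ := hS p hp
  exact ⟨h₁, h₂, hpn⟩
end
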